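/- Dimension reduction to bivariate stochastically increasing distributions (Proposition: dimension reduction). Let (Y,X) be a random vector with Y real-valued, let (F_u)_{u∈(0,1)} be a rearranged conditional distribution family for (Y,X) with rearranged quantile transform q^{↑u}_{Y|X}, and let U, V be independent, uniformly distributed on (0,1). Then: (i) q^{↑U}_{Y|X}(V) has the same distribution as Y; (ii) the bivariate random vector (q^{↑U}_{Y|X}(V), U) is stochastically increasing (SI); (iii) (q^{↑U}_{Y|X}(V), U) =ccx (Y,X). -/

import Mathlib

open MeasureTheory ProbabilityTheory Set Filter

noncomputable section

namespace CCXPaper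

variable {Ω Ω' : Type*} [MeasurableSpace Ω] [MeasurableSpace Ω']

/-- A measure is non-atomic in the measure-theoretic sense: every set of positive
measure contains a measurable subset of strictly smaller positive measure. -/
def Nonatomic (P : Measure Ω) : Prop :=
  ∀ s : Set Ω, MeasurableSet s → 0 < P s →
    ∃ t : Set Ω, MeasurableSet t ∧ t ⊆ s ∧ 0 < P t ∧ P t < P s

/-- Cumulative distribution function of the real random variable `Y` under `P`. -/
def cdfRV (P : Measure Ω) (Y : Ω → ℝ) (y : ℝ) : ℝ :=
  (P {ω | Y ω ≤ y}).toReal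

/-- Quantile function `q_Y(v) = inf {y | F_Y(y) ≥ v}`. -/
def quantRV (P : Measure Ω) (Y : Ω → ℝ) (v : ℝ) : ℝ :=
  sInf {y : ℝ | v ≤ cdfRV P Y y}

/-- Convex order between real random variables (on possibly different spaces):
`E[φ(S)] ≤ E[φ(T)]` for every convex `φ : ℝ → ℝ`. -/
def CxLE (P : Measure Ω) (S : Ω → ℝ) (P' : Measure Ω') (T : Ω' → ℝ) : Prop :=
  ∀ φ : ℝ → ℝ, ConvexOn ℝ Set.univ φ →
    ∫ ω, φ (S ω) ∂P ≤ ∫ ω, φ (T ω) ∂P'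

/-- Conditional probability `P(s | X)` as a random variable (a version of the
conditional expectation of the indicator of `s` given `σ(X)`). -/
def condProb {β : Type*} [MeasurableSpace β] (P : Measure Ω) (X : Ω → β) (s : Set Ω) :
    Ω → ℝ :=
  P[s.indicator (fun _ => (1 : ℝ)) | MeasurableSpace.comap X inferInstance]

/-- Conditional survival probability `P(Y ≥ y | X)`. -/
def condProbGE {β : Type*} [MeasurableSpace β] (P : Measure Ω) (Y : Ω → ℝ) (X : Ω → β)
    (y : ℝ) : Ω → ℝ :=
  condProb P X {ω | y ≤ Y ω}

/-- Conditional strict survival probability `P(Y > y | X)`. -/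
def condProbGT {β : Type*} [MeasurableSpace β] (P : Measure Ω) (Y : Ω → ℝ) (X : Ω → β)
    (y : ℝ) : Ω → ℝ :=
  condProb P X {ω | y < Y ω}

/-- Conditional cumulative probability `P(Y ≤ y | X)`. -/
def condProbLE {β : Type*} [MeasurableSpace β] (P : Measure Ω) (Y : Ω → ℝ) (X : Ω → β)
    (y : ℝ) : Ω → ℝ :=
  condProb P X {ω | Y ω ≤ y}

/-- Conditional strict cumulative probability `P(Y < y | X)`. -/
def condProbLT {β : Type*} [MeasurableSpace β] (P : Measure Ω) (Y : Ω → ℝ) (X : Ω → β)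
    (y : ℝ) : Ω → ℝ :=
  condProb P X {ω | Y ω < y}

/-- The conditional convex order `(Y, X) ⪯ccx (Y', X')`:
`P(Y ≥ q_Y(v) | X) ≤cx P(Y' ≥ q_{Y'}(v) | X')` for all `v ∈ (0,1)`. -/
def CCX {β γ : Type*} [MeasurableSpace β] [MeasurableSpace γ]
    (P : Measure Ω) (Y : Ω → ℝ) (X : Ω → β)
    (P' : Measure Ω') (Y' : Ω' → ℝ) (X' : Ω' → γ) : Prop :=
  ∀ v ∈ Set.Ioo (0 : ℝ) 1,
    CxLE P (condProbGE P Y X (quantRV P Y v)) P' (condProbGE P' Y' X' (quantRV P' Y' v))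

/-- Equality in the conditional convex order: `(Y, X) =ccx (Y', X')`. -/
def CCXeq {β γ : Type*} [MeasurableSpace β] [MeasurableSpace γ]
    (P : Measure Ω) (Y : Ω → ℝ) (X : Ω → β)
    (P' : Measure Ω') (Y' : Ω' → ℝ) (X' : Ω' → γ) : Prop :=
  CCX P Y X P' Y' X' ∧ CCX P' Y' X' P Y X

/-- `Y` and `Z` are conditionally independent given `X`: for every Borel `B ⊆ ℝ`,
`P(Y ∈ B | (X, Z)) = P(Y ∈ B | X)` almost surely. -/
def CondIndepGiven {β γ : Type*} [MeasurableSpace β] [MeasurableSpace γ]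
    (P : Measure Ω) (Y : Ω → ℝ) (Z : Ω → γ) (X : Ω → β) : Prop :=
  ∀ B : Set ℝ, MeasurableSet B →
    condProb P (fun ω => (X ω, Z ω)) (Y ⁻¹' B) =ᵐ[P] condProb P X (Y ⁻¹' B)

/-- `Y` is perfectly dependent on `X`: `Y = f(X)` a.s. for some measurable `f`. -/
def PerfectDep {β : Type*} [MeasurableSpace β] (P : Measure Ω) (Y : Ω → ℝ) (X : Ω → β) :
    Prop :=
  ∃ f : β → ℝ, Measurable f ∧ Y =ᵐ[P] fun ω => f (X ω)

/-- Concordance order for bivariate random vectors `(T, S) ≤c (T', S')`. -/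
def ConcordLE (P : Measure Ω) (T S : Ω → ℝ) (P' : Measure Ω') (T' S' : Ω' → ℝ) : Prop :=
  ∀ t s : ℝ,
    P {ω | T ω ≤ t ∧ S ω ≤ s} ≤ P' {ω | T' ω ≤ t ∧ S' ω ≤ s} ∧
    P {ω | t < T ω ∧ s < S ω} ≤ P' {ω | t < T' ω ∧ s < S' ω}

/-- The bivariate random vector `(W₁, W₂)` is stochastically increasing (SI):
for each bounded increasing `f`, a version of `E[f(W₁) | W₂]` is an increasing
function of `W₂`. -/
def SIvec (P : Measure Ω) (W₁ W₂ : Ω → ℝ) : Prop :=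
  ∀ f : ℝ → ℝ, Monotone f → (∃ C : ℝ, ∀ x, |f x| ≤ C) →
    ∃ m : ℝ → ℝ, Monotone m ∧
      (fun ω => m (W₂ ω)) =ᵐ[P]
        P[(fun ω => f (W₁ ω)) | MeasurableSpace.comap W₂ inferInstance]

/-- `G` is a cumulative distribution function on `ℝ`. -/
def IsCDF (G : ℝ → ℝ) : Prop :=
  Monotone G ∧ (∀ y : ℝ, ContinuousWithinAt G (Set.Ici y) y) ∧
    Tendsto G atBot (nhds 0) ∧ Tendsto G atTop (nhds 1)

/-- `(F u)_{u ∈ (0,1)}` is a rearranged conditional distribution family for `(Y, X)`: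
each `F u` is a cdf, `u ↦ F u y` is decreasing, and for each `y` the function
`u ↦ F u y` on `(0,1)` is a rearrangement of (i.e. equidistributed with)
`P(Y ≤ y | X)`. -/
def IsRearrangedFamily {β : Type*} [MeasurableSpace β]
    (P : Measure Ω) (Y : Ω → ℝ) (X : Ω → β) (F : ℝ → ℝ → ℝ) : Prop :=
  (∀ u ∈ Set.Ioo (0 : ℝ) 1, IsCDF (F u)) ∧
  (∀ y : ℝ, AntitoneOn (fun u => F u y) (Set.Ioo (0 : ℝ) 1)) ∧
  (∀ y w : ℝ,
    volume {u ∈ Set.Ioo (0 : ℝ) 1 | w ≤ F u y} = P {ω | w ≤ condProbLE P Y X y ω})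

/-- Rearranged quantile transform `q^{↑u}_{Y|X}(t) = inf {y | F_u(y) ≥ t}`. -/
def qArr (F : ℝ → ℝ → ℝ) (u t : ℝ) : ℝ :=
  sInf {y : ℝ | t ≤ F u y}

/-- The uniform distribution on `(0,1)`. -/
def unif01 : Measure ℝ := volume.restrict (Set.Ioo (0 : ℝ) 1)

/-- `hs` is a decreasing rearrangement of `h : (0,1)^k → ℝ`. -/
def IsDecRearrangement {k : ℕ} (h : (Fin k → ℝ) → ℝ) (hs : ℝ → ℝ) : Prop :=
  AntitoneOn hs (Set.Ioo (0 : ℝ) 1) ∧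
  ∀ w : ℝ,
    volume {t ∈ Set.Ioo (0 : ℝ) 1 | w ≤ hs t} =
      volume {x ∈ Set.pi Set.univ (fun _ : Fin k => Set.Ioo (0 : ℝ) 1) | w ≤ h x}

/-- Schur order `f ≺_S g` for functions on unit cubes, via decreasing rearrangements. -/
def SchurLE {d d' : ℕ} (f : (Fin d → ℝ) → ℝ) (g : (Fin d' → ℝ) → ℝ) : Prop :=
  ∃ fs gs : ℝ → ℝ, IsDecRearrangement f fs ∧ IsDecRearrangement g gs ∧
    (∀ x ∈ Set.Ioo (0 : ℝ) 1,
      (∫ t in Set.Ioo (0 : ℝ) x, fs t) ≤ ∫ t in Set.Ioo (0 : ℝ) x, gs t) ∧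
    (∫ t in Set.Ioo (0 : ℝ) 1, fs t) = ∫ t in Set.Ioo (0 : ℝ) 1, gs t

/-- `κ` is a Markov-kernel version of the conditional cdf of `Y` given `X`. -/
def IsCondCDFKernel {β : Type*} [MeasurableSpace β]
    (P : Measure Ω) (Y : Ω → ℝ) (X : Ω → β) (κ : β → ℝ → ℝ) : Prop :=
  (∀ y : ℝ, Measurable fun x => κ x y) ∧
  ∀ y : ℝ, (fun ω => κ (X ω) y) =ᵐ[P] condProbLE P Y X y

/-- The dependence measure `ξ_φ(Y, X)` (with conditional cdf kernel `κ`). -/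
def xiPhi {β : Type*} [MeasurableSpace β] (P : Measure Ω) (Y : Ω → ℝ) (X : Ω → β)
    (κ : β → ℝ → ℝ) (φ : ℝ → ℝ) : ℝ :=
  (∫ y1, ∫ y, φ ((if y1 ≤ y then (1 : ℝ) else 0) - cdfRV P Y y) ∂(P.map Y) ∂(P.map Y))⁻¹ *
    ∫ x, ∫ y, φ (κ x y - cdfRV P Y y) ∂(P.map Y) ∂(P.map X)

/-- The dependence measure `Λ_φ(Y, X)` (with conditional cdf kernel `κ`). -/
def LamPhi {β : Type*} [MeasurableSpace β] (P : Measure Ω) (Y : Ω → ℝ) (X : Ω → β)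
    (κ : β → ℝ → ℝ) (φ : ℝ → ℝ) : ℝ :=
  (∫ y12 : ℝ × ℝ, ∫ y,
      φ ((if y12.1 ≤ y then (1 : ℝ) else 0) - if y12.2 ≤ y then (1 : ℝ) else 0)
      ∂(P.map Y) ∂((P.map Y).prod (P.map Y)))⁻¹ *
    ∫ x12 : β × β, ∫ y, φ (κ x12.1 y - κ x12.2 y) ∂(P.map Y) ∂((P.map X).prod (P.map X))

/-- `φ` vanishes at `0` and is strictly convex at `0`. -/
def StrictlyConvexAtZero (φ : ℝ → ℝ) : Prop :=
  φ 0 = 0 ∧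
    ∀ s t lam : ℝ, s < 0 → 0 < t → 0 < lam → lam < 1 → lam * s + (1 - lam) * t = 0 →
      0 < lam * φ s + (1 - lam) * φ t

/-- `μ` is the (possibly degenerate) Gaussian distribution `N(m, S)` on `ℝ^d`,
characterized via its characteristic function. -/
def IsGaussianPi {d : ℕ} (μ : Measure (Fin d → ℝ)) (m : Fin d → ℝ)
    (S : Matrix (Fin d) (Fin d) ℝ) : Prop :=
  ∀ t : Fin d → ℝ,
    (∫ x, Complex.exp (Complex.I * ((∑ i, t i * x i : ℝ) : ℂ)) ∂μ) =
      Complex.exp (Complex.I * ((∑ i, t i * m i : ℝ) : ℂ) -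
        ((∑ i, ∑ j, t i * S i j * t j : ℝ) : ℂ) / 2)

/-- `Y` and `X` are comonotone. -/
def Comonotone (P : Measure Ω) (Y X : Ω → ℝ) : Prop :=
  ∃ U : Ω → ℝ, Measurable U ∧ P.map U = unif01 ∧
    P.map (fun ω => (Y ω, X ω)) =
      P.map (fun ω => (quantRV P Y (U ω), quantRV P X (U ω)))

/-- `Y` and `X` are countermonotone. -/
def Countermonotone (P : Measure Ω) (Y X : Ω → ℝ) : Prop :=
  ∃ U : Ω → ℝ, Measurable U ∧ P.map U = unif01 ∧
    P.map (fun ω => (Y ω, X ω)) =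
      P.map (fun ω => (quantRV P Y (U ω), quantRV P X (1 - U ω)))

end CCXPaper

namespace CCXPaper

lemma IsCDF.nonneg' {G : ℝ → ℝ} (h : IsCDF G) (y : ℝ) : 0 ≤ G y :=
  h.1.le_of_tendsto h.2.2.1 y

lemma IsCDF.le_one' {G : ℝ → ℝ} (h : IsCDF G) (y : ℝ) : G y ≤ 1 :=
  h.1.ge_of_tendsto h.2.2.2 y

lemma IsCDF.quantile_le_iff {G : ℝ → ℝ} (h : IsCDF G) {t : ℝ} (ht : t ∈ Ioo (0 : ℝ) 1) (y : ℝ) :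
    sInf {z : ℝ | t ≤ G z} ≤ y ↔ t ≤ G y := by
  obtain ⟨hm, hr, hb, htop⟩ := h
  have hne : {z : ℝ | t ≤ G z}.Nonempty := by
    obtain ⟨z, hz⟩ := ((tendsto_order.1 htop).1 t ht.2).exists
    exact ⟨z, hz.le⟩
  have hbdd : BddBelow {z : ℝ | t ≤ G z} := by
    obtain ⟨z, hz⟩ := ((tendsto_order.1 hb).2 t ht.1).exists
    refine ⟨z, fun w hw => ?_⟩
    by_contra hlt
    push Not at hlt
    exact absurd (lt_of_le_of_lt (le_trans hw (hm hlt.le)) hz) (lt_irrefl _)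
  constructor
  · intro hle
    have hgt : ∀ z, y < z → t ≤ G z := by
      intro z hz
      obtain ⟨w, hw, hwz⟩ := exists_lt_of_csInf_lt hne (lt_of_le_of_lt hle hz)
      exact le_trans hw (hm hwz.le)
    have htd : Tendsto G (nhdsWithin y (Ioi y)) (nhds (G y)) :=
      (hr y).mono_left (nhdsWithin_mono _ Ioi_subset_Ici_self)
    exact ge_of_tendsto htd (eventually_nhdsWithin_of_forall hgt)
  · intro hle
    exact csInf_le hbdd hle

instance : IsProbabilityMeasure unif01 := ⟨by simp [unif01]⟩

/-- Measurable version of the rearranged quantile transform. -/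
def qG (F : ℝ → ℝ → ℝ) : ℝ × ℝ → ℝ :=
  (Ioo (0 : ℝ) 1 ×ˢ Ioo (0 : ℝ) 1).indicator (fun p => qArr F p.1 p.2)

lemma qG_of_mem (F : ℝ → ℝ → ℝ) {u v : ℝ} (hu : u ∈ Ioo (0 : ℝ) 1) (hv : v ∈ Ioo (0 : ℝ) 1) :
    qG F (u, v) = qArr F u v :=
  indicator_of_mem (show (u, v) ∈ Ioo (0 : ℝ) 1 ×ˢ Ioo (0 : ℝ) 1 from ⟨hu, hv⟩) _

section
variable {Ω β : Type*} [MeasurableSpace Ω] [MeasurableSpace β] {P : Measure Ω}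
  {Y : Ω → ℝ} {X : Ω → β} {F : ℝ → ℝ → ℝ}

lemma measurable_qG (hF : IsRearrangedFamily P Y X F) : Measurable (qG F) := by
  apply measurable_of_Iic
  intro y
  obtain ⟨g, hg, hgF⟩ := (hF.2.1 y).exists_antitone_extension
    ⟨0, by rintro _ ⟨u, hu, rfl⟩; exact (hF.1 u hu).nonneg' y⟩
    ⟨1, by rintro _ ⟨u, hu, rfl⟩; exact (hF.1 u hu).le_one' y⟩
  have hS : MeasurableSet (Ioo (0 : ℝ) 1 ×ˢ Ioo (0 : ℝ) 1) :=
    measurableSet_Ioo.prod measurableSet_Ioo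
  have hA : MeasurableSet {p : ℝ × ℝ | p.2 ≤ g p.1} :=
    measurableSet_le measurable_snd (hg.measurable.comp measurable_fst)
  have hC : MeasurableSet {p : ℝ × ℝ | (0 : ℝ) ≤ y} := MeasurableSet.const _
  convert (hS.inter hA).union (hS.compl.inter hC) using 1
  ext ⟨u, v⟩
  by_cases h : (u, v) ∈ Ioo (0 : ℝ) 1 ×ˢ Ioo (0 : ℝ) 1
  · have h1 := qG_of_mem F h.1 h.2
    have h2 := (hF.1 u h.1).quantile_le_iff h.2 y
    have h3 : F u y = g u := hgF h.1
    simp only [mem_preimage, mem_Iic, h1, mem_union, mem_inter_iff, h, true_and, mem_compl_iff,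
      not_true_eq_false, false_and, or_false, mem_ofPred_eq, ← h3]
    exact h2
  · have h1 : qG F (u, v) = 0 := indicator_of_notMem h _
    simp only [mem_preimage, mem_Iic, h1, mem_union, mem_inter_iff, h, false_and, mem_compl_iff,
      not_false_eq_true, true_and, false_or, mem_ofPred_eq]

variable [IsProbabilityMeasure P]

lemma condExp_indep {U V : Ω → ℝ} (hU : Measurable U) (hV : Measurable V)
    (hVlaw : P.map V = unif01) (hUV : IndepFun U V P)
    {h : ℝ × ℝ → ℝ} (hh : Measurable h) {C : ℝ} (hC : ∀ x, |h x| ≤ C) :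
    P[fun ω => h (U ω, V ω) | MeasurableSpace.comap U inferInstance] =ᵐ[P]
      fun ω => ∫ v, h (U ω, v) ∂unif01 := by
  have hint : Integrable (fun ω => h (U ω, V ω)) P :=
    Integrable.of_bound (hh.comp (hU.prodMk hV)).aestronglyMeasurable C
      (ae_of_all _ fun ω => hC _)
  have h1 := condExp_prod_ae_eq_integral_condDistrib (μ := P) hU hV.aemeasurable
    hh.stronglyMeasurable hint
  have h2 : condDistrib V U P =ᵐ[P.map U] Kernel.const ℝ unif01 := by
    apply condDistrib_ae_eq_of_measure_eq_compProd U hV.aemeasurable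
    rw [Measure.compProd_const, ← hVlaw]
    exact (indepFun_iff_map_prod_eq_prod_map_map hU.aemeasurable hV.aemeasurable).1 hUV
  have h3 := ae_of_ae_map hU.aemeasurable h2
  filter_upwards [h1, h3] with ω e1 e3
  rw [e1, e3, Kernel.const_apply]

lemma condProb_ae [StandardBorelSpace β] {Z : Ω → ℝ} (hZ : Measurable Z) (hX : Measurable X) :
    ∀ s : Set ℝ, MeasurableSet s →
      condProb P X {ω | Z ω ∈ s} =ᵐ[P] fun ω => (condDistrib Z X P (X ω)).real s :=
  fun _ hs => (condDistrib_ae_eq_condExp hX hZ hs).symm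

lemma tendsto_real_Iic (μ : Measure ℝ) [IsProbabilityMeasure μ] (y : ℝ) :
    Tendsto (fun n : ℕ => 1 - μ.real (Iic (y - 1 / ((n : ℝ) + 1)))) atTop
      (nhds (μ.real (Ici y))) := by
  have hmono : Monotone fun n : ℕ => Iic (y - 1 / ((n : ℝ) + 1)) := by
    intro a b hab
    apply Iic_subset_Iic.2
    have := Nat.one_div_le_one_div (α := ℝ) hab
    linarith
  have h1 := tendsto_measure_iUnion_atTop (μ := μ) hmono
  have hU : ⋃ n : ℕ, Iic (y - 1 / ((n : ℝ) + 1)) = Iio y := by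
    ext z
    simp only [mem_iUnion, mem_Iic, mem_Iio]
    constructor
    · rintro ⟨n, hn⟩
      have := Nat.one_div_pos_of_nat (α := ℝ) (n := n)
      linarith
    · intro hz
      obtain ⟨n, hn⟩ := exists_nat_one_div_lt (sub_pos.2 hz)
      exact ⟨n, by linarith⟩
  rw [hU] at h1
  have h2 := (ENNReal.tendsto_toReal (measure_ne_top μ (Iio y))).comp h1
  have h3 : μ.real (Ici y) = 1 - μ.real (Iio y) := by
    rw [← compl_Iio, probReal_compl_eq_one_sub measurableSet_Iio]
  rw [h3]
  exact h2.const_sub 1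

lemma tendsto_phi [StandardBorelSpace β] {Z : Ω → ℝ} (hZ : Measurable Z) (hX : Measurable X)
    {φ : ℝ → ℝ} (hφ : Continuous φ) (y : ℝ) :
    Tendsto (fun n : ℕ => ∫ ω, φ (1 - condProbLE P Z X (y - 1 / ((n : ℝ) + 1)) ω) ∂P) atTop
      (nhds (∫ ω, φ (condProbGE P Z X y ω) ∂P)) := by
  have hle : ∀ z, condProbLE P Z X z =ᵐ[P] fun ω => (condDistrib Z X P (X ω)).real (Iic z) :=
    fun z => condProb_ae hZ hX (Iic z) measurableSet_Iic
  have hge : condProbGE P Z X y =ᵐ[P] fun ω => (condDistrib Z X P (X ω)).real (Ici y) :=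
    condProb_ae hZ hX (Ici y) measurableSet_Ici
  obtain ⟨C, hC⟩ := (isCompact_Icc (a := (0 : ℝ)) (b := 1)).exists_bound_of_continuousOn
    hφ.continuousOn
  refine tendsto_integral_of_dominated_convergence (fun _ => C) ?_ (integrable_const C) ?_ ?_
  · intro n
    have : StronglyMeasurable (condProbLE P Z X (y - 1 / ((n : ℝ) + 1))) :=
      stronglyMeasurable_condExp.mono hX.comap_le
    exact (hφ.measurable.comp (measurable_const.sub this.measurable)).aestronglyMeasurable
  · intro n
    filter_upwards [hle (y - 1 / ((n : ℝ) + 1))] with ω hω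
    apply hC
    rw [hω]
    exact ⟨sub_nonneg.2 measureReal_le_one, sub_le_self _ measureReal_nonneg⟩
  · have hall := ae_all_iff.2 fun n : ℕ => hle (y - 1 / ((n : ℝ) + 1))
    filter_upwards [hall, hge] with ω h1 h2
    rw [h2]
    simp only [h1]
    exact (hφ.tendsto _).comp (tendsto_real_Iic (condDistrib Z X P (X ω)) y)

lemma map_F (hX : Measurable X) (hF : IsRearrangedFamily P Y X F) (y : ℝ) :
    unif01.map (fun u => F u y) = P.map (condProbLE P Y X y) := by
  have hm : AEMeasurable (fun u => F u y) unif01 :=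
    aemeasurable_restrict_of_antitoneOn measurableSet_Ioo (hF.2.1 y)
  have hc : Measurable (condProbLE P Y X y) :=
    (stronglyMeasurable_condExp.mono hX.comap_le).measurable
  have := Measure.isProbabilityMeasure_map hm
  apply Measure.ext_of_Ici
  intro w
  rw [Measure.map_apply_of_aemeasurable hm measurableSet_Ici,
    Measure.map_apply hc measurableSet_Ici]
  refine Eq.trans ?_ (hF.2.2 y w)
  rw [unif01, Measure.restrict_apply' measurableSet_Ioo]
  congr 1
  ext u
  simp [and_comm]

lemma ae_mem {U : Ω → ℝ} (hU : Measurable U) (hUlaw : P.map U = unif01) :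
    ∀ᵐ ω ∂P, U ω ∈ Ioo (0 : ℝ) 1 := by
  apply ae_of_ae_map hU.aemeasurable (p := fun u => u ∈ Ioo (0 : ℝ) 1)
  rw [hUlaw]
  exact ae_restrict_mem measurableSet_Ioo

lemma condProbLE_W (hF : IsRearrangedFamily P Y X F)
    {U V : Ω → ℝ} (hU : Measurable U) (hV : Measurable V)
    (hUlaw : P.map U = unif01) (hVlaw : P.map V = unif01) (hUV : IndepFun U V P) (y : ℝ) :
    condProbLE P (fun ω => qG F (U ω, V ω)) U y =ᵐ[P] fun ω => F (U ω) y := by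
  have hms : MeasurableSet {p : ℝ × ℝ | qG F p ≤ y} := measurable_qG hF measurableSet_Iic
  have h1 := condExp_indep hU hV hVlaw hUV (h := {p : ℝ × ℝ | qG F p ≤ y}.indicator fun _ => 1)
    (measurable_const.indicator hms) (C := 1) (fun x => by
      by_cases hx : x ∈ {p : ℝ × ℝ | qG F p ≤ y} <;> simp [hx])
  refine EventuallyEq.trans h1 ?_
  filter_upwards [ae_mem hU hUlaw] with ω hω
  have h0 := (hF.1 _ hω).nonneg' y
  have h01 := (hF.1 _ hω).le_one' y
  have e : ∫ v, {p : ℝ × ℝ | qG F p ≤ y}.indicator (fun _ => (1 : ℝ)) (U ω, v) ∂unif01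
      = ∫ v, (Iic (F (U ω) y)).indicator (fun _ => (1 : ℝ)) v ∂unif01 := by
    apply integral_congr_ae
    have : ∀ᵐ v ∂unif01, v ∈ Ioo (0 : ℝ) 1 := ae_restrict_mem measurableSet_Ioo
    filter_upwards [this] with v hv
    have := (hF.1 _ hω).quantile_le_iff hv y
    simp only [indicator_apply, mem_ofPred_eq, qG_of_mem F hω hv, mem_Iic]
    exact if_congr this rfl rfl
  rw [e, integral_indicator measurableSet_Iic]
  simp only [integral_const, smul_eq_mul, mul_one, measureReal_restrict_apply_univ]
  rw [unif01, measureReal_restrict_apply' measurableSet_Ioo]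
  have hae : (Iic (F (U ω) y) ∩ Ioo (0 : ℝ) 1 : Set ℝ) =ᵐ[volume] Ioc (0 : ℝ) (F (U ω) y) := by
    have hne : ∀ᵐ x ∂(volume : Measure ℝ), x ≠ 1 := by
      simp [ae_iff]
    filter_upwards [hne] with x hx
    apply propext
    change (x ≤ _ ∧ (0 < x ∧ x < 1)) ↔ (0 < x ∧ x ≤ _)
    constructor
    · rintro ⟨a, b, c⟩; exact ⟨b, a⟩
    · rintro ⟨a, b⟩; exact ⟨b, a, lt_of_le_of_ne (b.trans h01) hx⟩
  rw [measureReal_congr hae]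
  simp [h0]

lemma map_condProbLE_W (hX : Measurable X) (hF : IsRearrangedFamily P Y X F)
    {U V : Ω → ℝ} (hU : Measurable U) (hV : Measurable V)
    (hUlaw : P.map U = unif01) (hVlaw : P.map V = unif01) (hUV : IndepFun U V P) (y : ℝ) :
    P.map (condProbLE P (fun ω => qG F (U ω, V ω)) U y) = P.map (condProbLE P Y X y) := by
  rw [Measure.map_congr (condProbLE_W hF hU hV hUlaw hVlaw hUV y), ← map_F hX hF y, ← hUlaw]
  have hm : AEMeasurable (fun u => F u y) unif01 :=
    aemeasurable_restrict_of_antitoneOn measurableSet_Ioo (hF.2.1 y)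
  rw [← hUlaw] at hm
  exact (AEMeasurable.map_map_of_aemeasurable hm hU.aemeasurable).symm

lemma integral_condProbLE_W (hX : Measurable X) (hF : IsRearrangedFamily P Y X F)
    {U V : Ω → ℝ} (hU : Measurable U) (hV : Measurable V)
    (hUlaw : P.map U = unif01) (hVlaw : P.map V = unif01) (hUV : IndepFun U V P) (y : ℝ)
    {ψ : ℝ → ℝ} (hψ : Continuous ψ) :
    ∫ ω, ψ (condProbLE P (fun ω => qG F (U ω, V ω)) U y ω) ∂P
      = ∫ ω, ψ (condProbLE P Y X y ω) ∂P := by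
  have hc : Measurable (condProbLE P Y X y) :=
    (stronglyMeasurable_condExp.mono hX.comap_le).measurable
  have hc' : Measurable (condProbLE P (fun ω => qG F (U ω, V ω)) U y) :=
    (stronglyMeasurable_condExp.mono hU.comap_le).measurable
  rw [← integral_map (f := ψ) hc.aemeasurable hψ.aestronglyMeasurable,
    ← integral_map (f := ψ) hc'.aemeasurable hψ.aestronglyMeasurable,
    map_condProbLE_W hX hF hU hV hUlaw hVlaw hUV y]

lemma integral_condProbLE (hX : Measurable X) {Z : Ω → ℝ} (hZ : Measurable Z) (y : ℝ) :
    ∫ ω, condProbLE P Z X y ω ∂P = (P.map Z).real (Iic y) := by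
  unfold condProbLE condProb
  rw [integral_condExp hX.comap_le]
  have : MeasurableSet {ω | Z ω ≤ y} := hZ measurableSet_Iic
  rw [integral_indicator this, measureReal_def, Measure.map_apply hZ measurableSet_Iic]
  simp [measureReal_def, preimage, Iic]

lemma map_W (hY : Measurable Y) (hX : Measurable X) (hF : IsRearrangedFamily P Y X F)
    {U V : Ω → ℝ} (hU : Measurable U) (hV : Measurable V)
    (hUlaw : P.map U = unif01) (hVlaw : P.map V = unif01) (hUV : IndepFun U V P) :
    P.map (fun ω => qG F (U ω, V ω)) = P.map Y := by
  have hW : Measurable (fun ω => qG F (U ω, V ω)) := (measurable_qG hF).comp (hU.prodMk hV)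
  have := Measure.isProbabilityMeasure_map (μ := P) hW.aemeasurable
  have := Measure.isProbabilityMeasure_map (μ := P) hY.aemeasurable
  apply Measure.ext_of_Iic
  intro y
  have h := integral_condProbLE_W hX hF hU hV hUlaw hVlaw hUV y continuous_id
  simp only [id] at h
  rw [integral_condProbLE hU hW, integral_condProbLE hX hY] at h
  exact (measureReal_eq_measureReal_iff).1 h

lemma si_W (hF : IsRearrangedFamily P Y X F)
    {U V : Ω → ℝ} (hU : Measurable U) (hV : Measurable V)
    (hUlaw : P.map U = unif01) (hVlaw : P.map V = unif01) (hUV : IndepFun U V P) :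
    SIvec P (fun ω => qG F (U ω, V ω)) U := by
  rintro f hf ⟨C, hC⟩
  have hfG : Measurable fun p => f (qG F p) := hf.measurable.comp (measurable_qG hF)
  have h1 := condExp_indep hU hV hVlaw hUV hfG (fun x => hC _)
  have hint : ∀ u, Integrable (fun v => f (qG F (u, v))) unif01 := fun u =>
    Integrable.of_bound (hfG.comp measurable_prodMk_left).aestronglyMeasurable C
      (ae_of_all _ fun ω => hC _)
  have hmon : MonotoneOn (fun u => ∫ v, f (qG F (u, v)) ∂unif01) (Ioo (0 : ℝ) 1) := by
    intro a ha b hb hab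
    apply integral_mono_ae (hint a) (hint b)
    have : ∀ᵐ v ∂unif01, v ∈ Ioo (0 : ℝ) 1 := ae_restrict_mem measurableSet_Ioo
    filter_upwards [this] with v hv
    apply hf
    rw [qG_of_mem F ha hv, qG_of_mem F hb hv]
    apply ((hF.1 a ha).quantile_le_iff hv _).2
    exact (((hF.1 b hb).quantile_le_iff hv _).1 le_rfl).trans (hF.2.1 _ ha hb hab)
  have hbd : ∀ u, |∫ v, f (qG F (u, v)) ∂unif01| ≤ C := by
    intro u
    have := norm_integral_le_of_norm_le_const (μ := unif01) (f := fun v => f (qG F (u, v)))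
      (C := C) (ae_of_all _ fun v => hC _)
    simpa using this
  obtain ⟨m, hm, hmeq⟩ := hmon.exists_monotone_extension
    ⟨-C, by rintro _ ⟨u, hu, rfl⟩; exact (abs_le.1 (hbd u)).1⟩
    ⟨C, by rintro _ ⟨u, hu, rfl⟩; exact (abs_le.1 (hbd u)).2⟩
  refine ⟨m, hm, EventuallyEq.trans ?_ h1.symm⟩
  filter_upwards [ae_mem hU hUlaw] with ω hω
  exact (hmeq hω).symm

lemma integral_condProbGE_W [StandardBorelSpace β] (hY : Measurable Y) (hX : Measurable X)
    (hF : IsRearrangedFamily P Y X F)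
    {U V : Ω → ℝ} (hU : Measurable U) (hV : Measurable V)
    (hUlaw : P.map U = unif01) (hVlaw : P.map V = unif01) (hUV : IndepFun U V P) (y : ℝ)
    {φ : ℝ → ℝ} (hφ : Continuous φ) :
    ∫ ω, φ (condProbGE P (fun ω => qG F (U ω, V ω)) U y ω) ∂P
      = ∫ ω, φ (condProbGE P Y X y ω) ∂P := by
  have hW : Measurable (fun ω => qG F (U ω, V ω)) := (measurable_qG hF).comp (hU.prodMk hV)
  have h1 := tendsto_phi (P := P) hW hU hφ y
  have h2 := tendsto_phi (P := P) hY hX hφ y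
  refine tendsto_nhds_unique h1 (h2.congr fun n => ?_)
  exact (integral_condProbLE_W hX hF hU hV hUlaw hVlaw hUV _
    (ψ := fun x => φ (1 - x)) (by fun_prop)).symm

end

end CCXPaper

open CCXPaper in
/-- Dimension reduction to bivariate SI distributions: with `(F_u)` a
rearranged conditional distribution family for `(Y, X)` and `U, V` independent uniform
on `(0,1)`: (i) `q^{↑U}_{Y|X}(V)` is distributed as `Y`; (ii) `(q^{↑U}_{Y|X}(V), U)` is
stochastically increasing; (iii) `(q^{↑U}_{Y|X}(V), U) =ccx (Y, X)`. -/
theorem ccx_dimension_reduction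
    {Ω : Type*} [MeasurableSpace Ω] (P : Measure Ω) [IsProbabilityMeasure P]
    (hPna : Nonatomic P)
    {p : ℕ} (Y : Ω → ℝ) (X : Ω → Fin p → ℝ)
    (hY : Measurable Y) (hX : Measurable X)
    (F : ℝ → ℝ → ℝ) (hF : IsRearrangedFamily P Y X F)
    (U V : Ω → ℝ) (hU : Measurable U) (hV : Measurable V)
    (hUlaw : P.map U = unif01) (hVlaw : P.map V = unif01)
    (hUV : IndepFun U V P) :
    P.map (fun ω => qArr F (U ω) (V ω)) = P.map Y ∧
    SIvec P (fun ω => qArr F (U ω) (V ω)) U ∧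
    CCXeq P (fun ω => qArr F (U ω) (V ω)) U P Y X := by
  have hWW : (fun ω => qArr F (U ω) (V ω)) =ᵐ[P] fun ω => qG F (U ω, V ω) := by
    filter_upwards [ae_mem hU hUlaw, ae_mem hV hVlaw] with ω h1 h2
    exact (qG_of_mem F h1 h2).symm
  have hmap : P.map (fun ω => qArr F (U ω) (V ω)) = P.map Y := by
    rw [Measure.map_congr hWW]
    exact map_W hY hX hF hU hV hUlaw hVlaw hUV
  have hWae : AEMeasurable (fun ω => qArr F (U ω) (V ω)) P :=
    ⟨_, (measurable_qG hF).comp (hU.prodMk hV), hWW⟩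
  have hcdf : cdfRV P (fun ω => qArr F (U ω) (V ω)) = cdfRV P Y := by
    funext y
    have h1 := Measure.map_apply_of_aemeasurable hWae (measurableSet_Iic (a := y))
    have h2 := Measure.map_apply (μ := P) hY (measurableSet_Iic (a := y))
    rw [hmap, h2] at h1
    exact congrArg ENNReal.toReal h1.symm
  have hq : quantRV P (fun ω => qArr F (U ω) (V ω)) = quantRV P Y := by
    funext v
    simp only [quantRV, hcdf]
  have key : ∀ y : ℝ, ∀ φ : ℝ → ℝ, ConvexOn ℝ Set.univ φ →
      ∫ ω, φ (condProbGE P (fun ω => qArr F (U ω) (V ω)) U y ω) ∂P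
        = ∫ ω, φ (condProbGE P Y X y ω) ∂P := by
    intro y φ hφ
    have hc : Continuous φ := continuousOn_univ.1 (hφ.continuousOn isOpen_univ)
    rw [← integral_condProbGE_W hY hX hF hU hV hUlaw hVlaw hUV y hc]
    have : condProbGE P (fun ω => qArr F (U ω) (V ω)) U y
        =ᵐ[P] condProbGE P (fun ω => qG F (U ω, V ω)) U y := by
      apply condExp_congr_ae
      filter_upwards [hWW] with ω hω
      simp only [indicator_apply, mem_ofPred_eq, hω]
    apply integral_congr_ae
    filter_upwards [this] with ω hω
    rw [hω]
  refine ⟨hmap, ?_, ?_, ?_⟩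
  · intro f hf hC
    obtain ⟨m, hm, he⟩ := si_W hF hU hV hUlaw hVlaw hUV f hf hC
    refine ⟨m, hm, he.trans (condExp_congr_ae ?_)⟩
    filter_upwards [hWW] with ω hω
    rw [hω]
  · intro v _ φ hφ
    rw [hq]
    exact (key _ φ hφ).le
  · intro v _ φ hφ
    rw [hq]
    exact (key _ φ hφ).ge
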